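/- Let α(τ) = Σ_{n≥0} a_n q^n be a weakly holomorphic modular form of negative even weight k on Γ_0(p) with integer coefficients, a_0 = 1, holomorphic at ∞, with a pole of order m at the cusp 0. If p^r | a_i for 1 ≤ i ≤ m and there exists F ∈ M_{-k}(Γ_0(p)) with leading coefficient 1, integer coefficients, and F ≡ 1 (mod p^r), then α ≡ 1 (mod p^r) (all coefficients a_n with n ≥ 1 are divisible by p^r). -/

import Mathlib

open UpperHalfPlane Complex CongruenceSubgroup MatrixGroups
open scoped ModularForm Real MatrixGroups Manifold

noncomputable section

/-- `q = e^{2 π i τ}`. -/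
def qexp (τ : UpperHalfPlane) : ℂ := Complex.exp (2 * π * Complex.I * τ)

/-- `f` has the `q`-expansion `∑ c n qⁿ` at `∞`, with only finitely many negative terms. -/
def HasExpansion (f : UpperHalfPlane → ℂ) (c : ℤ → ℂ) : Prop :=
  (∃ N : ℤ, ∀ n : ℤ, n < N → c n = 0) ∧
    ∀ τ : UpperHalfPlane, HasSum (fun n : ℤ => c n * qexp τ ^ n) (f τ)

/-- Weakly holomorphic modular forms of weight `k` on `Γ`, together with their
Fourier coefficients. -/
structure WhmForm (Γ : Subgroup SL(2, ℤ)) (k : ℤ) where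
  toFun : UpperHalfPlane → ℂ
  coeff : ℤ → ℂ
  holo : MDifferentiable 𝓘(ℂ) 𝓘(ℂ) toFun
  slash_eq : ∀ γ ∈ Γ, toFun ∣[k] γ = toFun
  expansion : HasExpansion toFun coeff

/-- `f = q^{-m} + O(q^{ℓ+1})`. -/
def IsBasisElt {Γ : Subgroup SL(2, ℤ)} (k ℓ m : ℤ) (f : WhmForm Γ k) : Prop :=
  f.coeff (-m) = 1 ∧ ∀ n : ℤ, n ≠ -m → n ≤ ℓ → f.coeff n = 0

/-- multiplication of a point of the upper half plane by a positive real number. -/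
def rscale (a : ℝ) (ha : 0 < a) (τ : UpperHalfPlane) : UpperHalfPlane :=
  ⟨a * τ, by simpa [Complex.mul_im] using mul_pos ha τ.2⟩

/-- `τ ↦ -1/τ` on the upper half plane. -/
def neginv (τ : UpperHalfPlane) : UpperHalfPlane :=
  ⟨(-(τ : ℂ))⁻¹, τ.im_inv_neg_coe_pos⟩

/-- `f` has the holomorphic `q`-expansion `∑_{n ≥ 0} c n qⁿ` at `∞`. -/
def HasHoloExpansion (f : UpperHalfPlane → ℂ) (c : ℕ → ℂ) : Prop :=
  ∀ τ : UpperHalfPlane, HasSum (fun n : ℕ => c n * qexp τ ^ n) (f τ)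

/-- `f` has the expansion `τ^{-k} f(-1/τ) = ∑ c n e^{2πinτ/p}` at the cusp `0` of `Γ₀(p)`,
with only finitely many negative terms. -/
def HasExpansionAtZero (p : ℕ) (k : ℤ) (f : UpperHalfPlane → ℂ) (c : ℤ → ℂ) : Prop :=
  (∃ N : ℤ, ∀ n : ℤ, n < N → c n = 0) ∧
    ∀ τ : UpperHalfPlane,
      HasSum (fun n : ℤ => c n * Complex.exp (2 * π * Complex.I * n * τ / p))
        ((τ : ℂ) ^ (-k) * f (neginv τ))

/-- `g` is given on the open unit disc by the power series `A`. -/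
def HasDiscSeries (g : ℂ → ℂ) (A : PowerSeries ℂ) : Prop :=
  ∀ z : ℂ, ‖z‖ < 1 → HasSum (fun n : ℕ => A.coeff n * z ^ n) (g z)

namespace HasDiscSeries

variable {g h : ℂ → ℂ} {A B : PowerSeries ℂ}

lemma summable_norm (hg : HasDiscSeries g A) {z : ℂ} (hz : ‖z‖ < 1) :
    Summable fun n : ℕ => ‖A.coeff n * z ^ n‖ :=
  (hg z hz).summable.norm

lemma congr (hg : HasDiscSeries g A) (hgh : ∀ z : ℂ, ‖z‖ < 1 → g z = h z) :
    HasDiscSeries h A :=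
  fun z hz => hgh z hz ▸ hg z hz

lemma add (hg : HasDiscSeries g A) (hh : HasDiscSeries h B) :
    HasDiscSeries (fun z => g z + h z) (A + B) := fun z hz => by
  simpa [add_mul] using (hg z hz).add (hh z hz)

lemma sub (hg : HasDiscSeries g A) (hh : HasDiscSeries h B) :
    HasDiscSeries (fun z => g z - h z) (A - B) := fun z hz => by
  simpa [sub_mul] using (hg z hz).sub (hh z hz)

lemma mul (hg : HasDiscSeries g A) (hh : HasDiscSeries h B) :
    HasDiscSeries (fun z => g z * h z) (A * B) := fun z hz => by
  have h1 := hg.summable_norm hz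
  have h2 := hh.summable_norm hz
  have key := (summable_norm_sum_mul_antidiagonal_of_summable_norm h1 h2).of_norm.hasSum
  rw [← tsum_mul_tsum_eq_tsum_sum_antidiagonal_of_summable_norm h1 h2, (hg z hz).tsum_eq,
    (hh z hz).tsum_eq] at key
  refine key.congr_fun ?_
  intro n
  rw [PowerSeries.coeff_mul, Finset.sum_mul]
  refine Finset.sum_congr rfl fun x hx => ?_
  rw [← Finset.HasAntidiagonal.mem_antidiagonal.mp hx, pow_add]
  ring

lemma const (c : ℂ) : HasDiscSeries (fun _ => c) (PowerSeries.C c) := fun z _ => by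
  convert! hasSum_ite_eq 0 c using 2 with n
  rw [PowerSeries.coeff_C]
  split_ifs with hn <;> simp [hn]

lemma one : HasDiscSeries (fun _ => 1) 1 := by
  simpa using const 1

lemma id : HasDiscSeries (fun z => z) PowerSeries.X := fun z _ => by
  convert! hasSum_ite_eq 1 z using 2 with n
  rw [PowerSeries.coeff_X]
  split_ifs with hn <;> simp [hn]

lemma pow (hg : HasDiscSeries g A) (n : ℕ) : HasDiscSeries (fun z => g z ^ n) (A ^ n) := by
  induction n with
  | zero => simpa using one
  | succ n ih => simpa only [pow_succ] using ih.mul hg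

lemma prod {g : ℕ → ℂ → ℂ} {A : ℕ → PowerSeries ℂ} (hg : ∀ i, HasDiscSeries (g i) (A i))
    (s : Finset ℕ) : HasDiscSeries (fun z => ∏ i ∈ s, g i z) (∏ i ∈ s, A i) := by
  classical
  induction s using Finset.induction_on with
  | empty => simpa using one
  | insert a s ha ih => simpa only [Finset.prod_insert ha] using (hg a).mul ih

lemma hasFPowerSeriesOnBall (hg : HasDiscSeries g A) :
    HasFPowerSeriesOnBall g (.ofScalars ℂ fun n => A.coeff n) 0 1 := by
  constructor
  · refine le_of_forall_lt_imp_le_of_dense fun r hr => ?_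
    lift r to NNReal using hr.ne_top
    apply FormalMultilinearSeries.le_radius_of_summable
    simpa [smul_eq_mul, norm_mul, mul_comm, mul_left_comm, mul_assoc] using
      hg.summable_norm (z := (r : ℂ)) (by simpa using hr)
  · simp
  · intro y hy
    rw [← ENNReal.coe_one, Metric.eball_coe, NNReal.coe_one, mem_ball_zero_iff] at hy
    simpa [mul_comm] using hg y hy

lemma differentiableOn (hg : HasDiscSeries g A) : DifferentiableOn ℂ g (Metric.ball 0 1) := by
  have := hg.hasFPowerSeriesOnBall.differentiableOn
  rwa [← ENNReal.coe_one, Metric.eball_coe, NNReal.coe_one] at this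

lemma of_differentiableOn (hg : DifferentiableOn ℂ g (Metric.ball 0 1)) :
    HasDiscSeries g (.mk fun n => (n.factorial : ℂ)⁻¹ * iteratedDeriv n g 0) := fun z hz => by
  have := hasSum_taylorSeries_on_ball hg (z := z) (by simpa using hz)
  refine this.congr_fun fun n => ?_
  simp [mul_comm, mul_left_comm]

lemma unique (hg : HasDiscSeries g A) (hg' : HasDiscSeries g B) : A = B := by
  have := hg.hasFPowerSeriesOnBall.hasFPowerSeriesAt.eq_formalMultilinearSeries
    hg'.hasFPowerSeriesOnBall.hasFPowerSeriesAt
  ext n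
  simpa [FormalMultilinearSeries.coeff_ofScalars] using
    congrArg (fun p : FormalMultilinearSeries ℂ ℂ ℂ => p.coeff n) this

lemma coeff_eq_iteratedDeriv (hg : HasDiscSeries g A) (n : ℕ) :
    A.coeff n = (n.factorial : ℂ)⁻¹ * iteratedDeriv n g 0 := by
  rw [hg.unique (of_differentiableOn hg.differentiableOn), PowerSeries.coeff_mk]

lemma apply_zero (hg : HasDiscSeries g A) : g 0 = A.constantCoeff := by
  rw [← PowerSeries.coeff_zero_eq_constantCoeff_apply]
  refine (hg 0 (by simp)).unique ?_
  convert! hasSum_ite_eq 0 (A.coeff 0) using 2 with n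
  split_ifs with hn <;> simp [hn]

lemma inv (hg : HasDiscSeries g A) (hne : ∀ z : ℂ, ‖z‖ < 1 → g z ≠ 0) (hAB : A * B = 1) :
    HasDiscSeries (fun z => (g z)⁻¹) B := by
  have hd : DifferentiableOn ℂ (fun z => (g z)⁻¹) (Metric.ball 0 1) :=
    hg.differentiableOn.fun_inv fun z hz => hne z (by simpa using hz)
  have hC := of_differentiableOn hd
  have h1 := (hg.mul hC).congr (h := fun _ => 1) fun z hz => mul_inv_cancel₀ (hne z hz)
  rwa [← left_inv_eq_right_inv (by rw [mul_comm]; exact h1.unique one) hAB]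

/-- Dividing a power series without constant term by the coordinate. -/
lemma exists_of_X_mul (hg : HasDiscSeries g (PowerSeries.X * A)) :
    ∃ h : ℂ → ℂ, HasDiscSeries h A ∧ ∀ z : ℂ, ‖z‖ < 1 → g z = z * h z := by
  have hs : ∀ z : ℂ, ‖z‖ < 1 → Summable fun n : ℕ => A.coeff n * z ^ n := fun z hz => by
    rcases eq_or_ne z 0 with rfl | hz0
    · exact summable_of_ne_finset_zero (s := {0}) fun n hn => by simp_all
    · have := (summable_nat_add_iff 1).mpr (hg z hz).summable
      refine (this.mul_left z⁻¹).congr fun n => ?_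
      rw [PowerSeries.coeff_succ_X_mul, pow_succ]
      field_simp
  have hh : HasDiscSeries (fun z => ∑' n : ℕ, A.coeff n * z ^ n) A := fun z hz => (hs z hz).hasSum
  exact ⟨_, hh, fun z hz => (hg z hz).unique (id.mul hh z hz)⟩

end HasDiscSeries

lemma TendstoLocallyUniformlyOn.iteratedDeriv_complex {F : ℕ → ℂ → ℂ} {f : ℂ → ℂ} {U : Set ℂ}
    (hU : IsOpen U) (n : ℕ) (hF : TendstoLocallyUniformlyOn F f Filter.atTop U)
    (hd : ∀ N, DifferentiableOn ℂ (F N) U) :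
    TendstoLocallyUniformlyOn (fun N => iteratedDeriv n (F N)) (iteratedDeriv n f)
      Filter.atTop U := by
  induction n generalizing F f with
  | zero => simpa using hF
  | succ n ih =>
    simp only [iteratedDeriv_succ']
    exact ih (hF.deriv (.of_forall hd) hU) fun N => (hd N).deriv hU

lemma isClosed_range_intCast_complex : IsClosed (Set.range ((↑) : ℤ → ℂ)) := by
  have := (Complex.isometry_ofReal.isClosedEmbedding.comp
    Int.isClosedEmbedding_coe_real).isClosed_range
  convert! this using 2

/-- A locally uniform limit of functions with integral power series has an integral power
series. -/
lemma HasDiscSeries.exists_int_of_tendsto {F : ℕ → ℂ → ℂ} {f : ℂ → ℂ}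
    {A : ℕ → PowerSeries ℤ}
    (hF : TendstoLocallyUniformlyOn F f Filter.atTop (Metric.ball (0 : ℂ) 1))
    (hA : ∀ N, HasDiscSeries (F N) ((A N).map (Int.castRingHom ℂ))) :
    ∃ B : PowerSeries ℤ, HasDiscSeries f (B.map (Int.castRingHom ℂ)) := by
  have hd := hF.differentiableOn (.of_forall fun N => (hA N).differentiableOn) Metric.isOpen_ball
  have hf := HasDiscSeries.of_differentiableOn hd
  have key : ∀ n : ℕ, (n.factorial : ℂ)⁻¹ * iteratedDeriv n f 0 ∈ Set.range ((↑) : ℤ → ℂ) := by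
    intro n
    refine isClosed_range_intCast_complex.mem_of_tendsto (b := Filter.atTop)
      (f := fun N => (n.factorial : ℂ)⁻¹ * iteratedDeriv n (F N) 0) ?_ (.of_forall fun N => ?_)
    · exact ((hF.iteratedDeriv_complex Metric.isOpen_ball n
        fun N => (hA N).differentiableOn).tendsto_at (by simp)).const_mul _
    · exact ⟨(A N).coeff n, by rw [← (hA N).coeff_eq_iteratedDeriv n]; simp⟩
  choose b hb using key
  refine ⟨.mk b, ?_⟩
  convert! hf using 1
  ext n
  simp [hb]

/-- Euler's product `∏ (1 - zⁿ)`. -/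
def eulerProd (z : ℂ) : ℂ := ∏' n : ℕ, (1 - z ^ (n + 1))

lemma eulerProd_ne_zero {z : ℂ} (hz : ‖z‖ < 1) : eulerProd z ≠ 0 := by
  refine tprod_one_add_ne_zero_of_summable (f := fun n => -z ^ (n + 1)) (fun n => ?_) ?_
  · rw [← sub_eq_add_neg, sub_ne_zero]
    intro h
    have := congrArg norm h
    rw [norm_pow, norm_one] at this
    exact (pow_lt_one₀ (norm_nonneg _) hz n.succ_ne_zero).ne this.symm
  · simpa using (summable_nat_add_iff 1).mpr (summable_geometric_of_lt_one (norm_nonneg _) hz)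

lemma norm_pow_lt_one {z : ℂ} (hz : ‖z‖ < 1) {d : ℕ} (hd : d ≠ 0) : ‖z ^ d‖ < 1 := by
  rw [norm_pow]
  exact pow_lt_one₀ (norm_nonneg _) hz hd

lemma eulerProd_zero : eulerProd 0 = 1 := by simp [eulerProd]

lemma exists_hasDiscSeries_eulerProd {d : ℕ} (hd : d ≠ 0) :
    ∃ B : PowerSeries ℤ, B.constantCoeff = 1 ∧
      HasDiscSeries (fun z => eulerProd (z ^ d)) (B.map (Int.castRingHom ℂ)) := by
  have h1 : TendstoLocallyUniformlyOn
      (fun N (z : ℂ) => ∏ n ∈ Finset.range N, (1 - (z ^ d) ^ (n + 1)))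
      (fun z => eulerProd (z ^ d)) Filter.atTop (Metric.ball (0 : ℂ) 1) := by
    have h0 : TendstoLocallyUniformlyOn (fun N (z : ℂ) => ∏ n ∈ Finset.range N, (1 - z ^ (n + 1)))
        eulerProd Filter.atTop (Metric.ball (0 : ℂ) 1) :=
      (ModularForm.multipliableLocallyUniformlyOn_one_sub_pow.hasProdLocallyUniformlyOn
        ).tendstoLocallyUniformlyOn_finsetRange
    exact h0.comp (fun z : ℂ => z ^ d)
      (fun z hz => by simpa using norm_pow_lt_one (d := d) (by simpa using hz) hd) (by fun_prop)
  obtain ⟨B, hB⟩ := HasDiscSeries.exists_int_of_tendsto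
    (A := fun N => ∏ n ∈ Finset.range N, (1 - (PowerSeries.X ^ d) ^ (n + 1))) h1 fun N => by
      simp only [map_prod, map_sub, map_one, map_pow, PowerSeries.map_X]
      exact HasDiscSeries.prod (fun n => .sub .one ((HasDiscSeries.id.pow d).pow (n + 1))) _
  refine ⟨B, ?_, hB⟩
  have := hB.apply_zero
  rw [zero_pow hd, eulerProd_zero] at this
  exact_mod_cast (show ((B.constantCoeff : ℤ) : ℂ) = 1 by
    rw [this, ← PowerSeries.coeff_zero_eq_constantCoeff_apply,
      ← PowerSeries.coeff_zero_eq_constantCoeff_apply, PowerSeries.coeff_map]; simp)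

section Generators

open Matrix.SpecialLinearGroup

/-- The unipotent matrix `(1 0; n 1)`. -/
def lowerUnipotent (n : ℤ) : SL(2, ℤ) := ⟨!![1, 0; n, 1], by simp⟩

/-- The element `(2 -1; 5 -2)` of order `4`. -/
def elliptic : SL(2, ℤ) := ⟨!![2, -1; 5, -2], by simp⟩

/-- The element `(-2 -1; 5 2)` of order `4`. -/
def elliptic' : SL(2, ℤ) := ⟨!![-2, -1; 5, 2], by simp⟩

lemma exists_two_mul_abs_add_le (x : ℤ) {y : ℤ} (hy : y ≠ 0) : ∃ k : ℤ, 2 * |x + k * y| ≤ |y| := by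
  have h1 := Int.emod_nonneg x hy
  have h2 := Int.emod_lt_abs x hy
  have h3 := Int.mul_ediv_add_emod x y
  rcases le_total (2 * (x % y)) |y| with h | h
  · refine ⟨-(x / y), ?_⟩
    rw [show x + -(x / y) * y = x % y by linarith [mul_comm y (x / y)], abs_of_nonneg h1]
    exact h
  · rcases abs_cases y with ⟨hy', -⟩ | ⟨hy', -⟩
    · refine ⟨-(x / y) - 1, ?_⟩
      rw [show x + (-(x / y) - 1) * y = x % y - |y| by rw [hy']; linarith [mul_comm y (x / y)],
        abs_of_nonpos (by linarith)]
      linarith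
    · refine ⟨-(x / y) + 1, ?_⟩
      rw [show x + (-(x / y) + 1) * y = x % y - |y| by rw [hy']; linarith [mul_comm y (x / y)],
        abs_of_nonpos (by linarith)]
      linarith

lemma abs_sub_lt_of_abs_add_ge {x y : ℤ} (h1 : ¬|x| < 2 * |y|) (h2 : 2 * |x| ≤ 5 * |y|)
    (hy : 0 < |y|) (h3 : ¬|-x - 2 * y| < |y|) : |-x + 2 * y| < |y| := by
  rcases abs_cases x with hx' | hx' <;> rcases abs_cases y with hy' | hy' <;>
    rcases abs_cases (-x - 2 * y) with h' | h' <;> rcases abs_cases (-x + 2 * y) with h'' | h'' <;>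
    omega

lemma mul_T_zpow_apply_one_one (γ : SL(2, ℤ)) (j : ℤ) :
    (γ * ModularGroup.T ^ j) 1 1 = γ 1 1 + j * γ 1 0 := by
  rw [coe_mul, ModularGroup.coe_T_zpow, Matrix.mul_apply, Fin.sum_univ_two]
  simp; ring

lemma mul_T_zpow_apply_one_zero (γ : SL(2, ℤ)) (j : ℤ) :
    (γ * ModularGroup.T ^ j) 1 0 = γ 1 0 := by
  rw [coe_mul, ModularGroup.coe_T_zpow, Matrix.mul_apply, Fin.sum_univ_two]
  simp

lemma mul_lowerUnipotent_apply_one_one (γ : SL(2, ℤ)) (n : ℤ) :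
    (γ * lowerUnipotent n) 1 1 = γ 1 1 := by
  rw [coe_mul, Matrix.mul_apply, Fin.sum_univ_two]
  simp [lowerUnipotent]

lemma mul_lowerUnipotent_apply_one_zero (γ : SL(2, ℤ)) (n : ℤ) :
    (γ * lowerUnipotent n) 1 0 = γ 1 0 + n * γ 1 1 := by
  rw [coe_mul, Matrix.mul_apply, Fin.sum_univ_two]
  simp [lowerUnipotent]; ring

lemma mul_elliptic_apply (γ : SL(2, ℤ)) :
    (γ * elliptic) 1 0 = 2 * γ 1 0 + 5 * γ 1 1 ∧ (γ * elliptic) 1 1 = -γ 1 0 - 2 * γ 1 1 := by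
  constructor <;> rw [coe_mul, Matrix.mul_apply, Fin.sum_univ_two] <;> simp [elliptic] <;> ring

lemma mul_elliptic'_apply (γ : SL(2, ℤ)) :
    (γ * elliptic') 1 0 = -2 * γ 1 0 + 5 * γ 1 1 ∧
      (γ * elliptic') 1 1 = -γ 1 0 + 2 * γ 1 1 := by
  constructor <;> rw [coe_mul, Matrix.mul_apply, Fin.sum_univ_two] <;> simp [elliptic'] <;> ring

lemma det_eq (γ : SL(2, ℤ)) : γ 0 0 * γ 1 1 - γ 0 1 * γ 1 0 = 1 := by
  rw [← Matrix.det_fin_two, γ.det_coe]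

lemma Gamma0_mem_iff_dvd {p : ℕ} {γ : SL(2, ℤ)} : γ ∈ Gamma0 p ↔ (p : ℤ) ∣ γ 1 0 := by
  rw [Gamma0_mem, ZMod.intCast_zmod_eq_zero_iff_dvd]

/-- Explicit generators of `Γ₀(p)` for `p = 2, 3, 5`. -/
lemma Gamma0_le_of_generators {p : ℕ} (hp : p ∈ ({2, 3, 5} : Set ℕ)) {H : Subgroup SL(2, ℤ)}
    (hneg : -1 ∈ H) (hT : ∀ j : ℤ, ModularGroup.T ^ j ∈ H)
    (hL : ∀ n : ℤ, lowerUnipotent (p * n) ∈ H) (he : p = 5 → elliptic ∈ H ∧ elliptic' ∈ H) :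
    Gamma0 p ≤ H := by
  suffices h : ∀ n : ℕ, ∀ γ : SL(2, ℤ), (γ 1 1).natAbs = n → (p : ℤ) ∣ γ 1 0 → γ ∈ H from
    fun γ hγ => h _ γ rfl (Gamma0_mem_iff_dvd.mp hγ)
  intro n
  induction n using Nat.strong_induction_on with
  | _ n ih =>
  intro γ hn ⟨c, hc⟩
  have hd : γ 1 1 ≠ 0 := fun h0 => by
    have := det_eq γ
    rw [h0, hc, mul_zero, zero_sub] at this
    have h1 : (p : ℤ) ∣ 1 := ⟨-(γ 0 1 * c), this.symm.trans (by ring)⟩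
    rcases hp with rfl | rfl | rfl <;> norm_num at h1
  obtain ⟨k, hk⟩ := exists_two_mul_abs_add_le c hd
  rw [← H.mul_mem_cancel_right (hL k)]
  set δ := γ * lowerUnipotent (p * k) with hδ
  have hδ1 : δ 1 1 = γ 1 1 := mul_lowerUnipotent_apply_one_one _ _
  have hδ0 : δ 1 0 = p * (c + k * γ 1 1) := by
    rw [hδ, mul_lowerUnipotent_apply_one_zero, hc]; ring
  have habs : 2 * |δ 1 0| ≤ p * |δ 1 1| := by
    rw [hδ0, hδ1, abs_mul, Nat.abs_cast]
    nlinarith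
  rw [← hδ1] at hn hd
  have hdvd : (p : ℤ) ∣ δ 1 0 := ⟨_, hδ0⟩
  clear_value δ
  by_cases hz : δ 1 0 = 0
  · have hdet := det_eq δ
    rw [hz, mul_zero, sub_zero] at hdet
    rcases Int.eq_one_or_neg_one_of_mul_eq_one' hdet with ⟨h0, h1⟩ | ⟨h0, h1⟩
    · convert! hT (δ 0 1)
      ext i j
      rw [ModularGroup.coe_T_zpow]
      fin_cases i <;> fin_cases j <;> simp [h0, h1, hz]
    · rw [← H.mul_mem_cancel_left hneg]
      convert! hT (-δ 0 1)
      ext i j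
      rw [ModularGroup.coe_T_zpow]
      fin_cases i <;> fin_cases j <;> simp [h0, h1, hz]
  by_cases hlt : |δ 1 0| < 2 * |δ 1 1|
  · obtain ⟨j, hj⟩ := exists_two_mul_abs_add_le (δ 1 1) hz
    rw [← H.mul_mem_cancel_right (hT j)]
    refine ih _ ?_ _ rfl (by rwa [mul_T_zpow_apply_one_zero])
    rw [← hn, mul_T_zpow_apply_one_one, ← Int.ofNat_lt, Int.natCast_natAbs, Int.natCast_natAbs]
    linarith
  have hpos := abs_pos.mpr hd
  obtain rfl : p = 5 := by
    rcases hp with rfl | rfl | rfl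
    · push_cast at habs; linarith
    · push_cast at habs; linarith
    · rfl
  obtain ⟨he1, he2⟩ := he rfl
  have h1 := mul_elliptic_apply δ
  have h2 := mul_elliptic'_apply δ
  have hdvd' : (5 : ℤ) ∣ δ 1 0 := by exact_mod_cast hdvd
  push_cast at habs
  by_cases hlt' : |-δ 1 0 - 2 * δ 1 1| < |δ 1 1|
  · rw [← H.mul_mem_cancel_right he1]
    refine ih _ ?_ _ rfl ?_
    · rw [← hn, h1.2, ← Int.ofNat_lt, Int.natCast_natAbs, Int.natCast_natAbs]
      exact hlt'
    · rw [h1.1]; push_cast; omega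
  · rw [← H.mul_mem_cancel_right he2]
    refine ih _ ?_ _ rfl ?_
    · rw [← hn, h2.2, ← Int.ofNat_lt, Int.natCast_natAbs, Int.natCast_natAbs]
      exact abs_sub_lt_of_abs_add_ge hlt habs hpos hlt'
    · rw [h2.1]; push_cast; omega

end Generators

section Hauptmodul

lemma norm_qexp_lt_one (τ : ℍ) : ‖qexp τ‖ < 1 := by
  rw [qexp, Complex.norm_exp, Real.exp_lt_one_iff]
  have := mul_pos Real.two_pi_pos τ.im_pos
  simpa using this

lemma qexp_ne_zero (τ : ℍ) : qexp τ ≠ 0 := Complex.exp_ne_zero _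

lemma qexp_rscale (n : ℕ) (hn : (0 : ℝ) < n) (τ : ℍ) : qexp (rscale n hn τ) = qexp τ ^ n := by
  rw [qexp, qexp, ← Complex.exp_nat_mul]
  congr 1
  simp only [rscale, ofReal_natCast]
  ring

lemma qexp_T_zpow_smul (j : ℤ) (τ : ℍ) : qexp (ModularGroup.T ^ j • τ) = qexp τ := by
  rw [qexp, qexp, modular_T_zpow_smul, coe_vadd, Complex.exp_eq_exp_iff_exists_int]
  exact ⟨j, by push_cast; ring⟩

lemma mdifferentiable_comp_qexp {g : ℂ → ℂ} (hg : DifferentiableOn ℂ g (Metric.ball 0 1)) :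
    MDifferentiable 𝓘(ℂ) 𝓘(ℂ) fun τ : ℍ => g (qexp τ) := by
  rw [UpperHalfPlane.mdifferentiable_iff]
  have h1 : DifferentiableOn ℂ (fun z : ℂ => g (Complex.exp (2 * π * Complex.I * z)))
      {z | 0 < z.im} :=
    hg.comp (by fun_prop) fun z hz => by simpa [qexp] using norm_qexp_lt_one ⟨z, hz⟩
  refine h1.congr fun z hz => ?_
  simp [qexp, ofComplex_apply_of_im_pos hz]

lemma continuous_comp_qexp {g : ℂ → ℂ} (hg : DifferentiableOn ℂ g (Metric.ball 0 1)) :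
    Continuous fun τ : ℍ => g (qexp τ) :=
  (mdifferentiable_comp_qexp hg).continuous

lemma coe_smul_eq (γ : SL(2, ℤ)) (τ : ℍ) :
    (↑(γ • τ) : ℂ) = (γ 0 0 * τ + γ 0 1) / (γ 1 0 * τ + γ 1 1) := by
  simpa using coe_specialLinearGroup_apply γ τ

lemma denom_ne_zero' (γ : SL(2, ℤ)) (τ : ℍ) : (γ 1 0 * τ + γ 1 1 : ℂ) ≠ 0 := by
  simpa [denom] using denom_ne_zero (γ : GL (Fin 2) ℝ) τ

lemma continuous_SL2Z_smul (γ : SL(2, ℤ)) : Continuous fun τ : ℍ => γ • τ := by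
  rw [UpperHalfPlane.isOpenEmbedding_coe.isInducing.continuous_iff]
  refine Continuous.congr ?_ fun τ => (coe_smul_eq γ τ).symm
  exact Continuous.div (by fun_prop) (by fun_prop) (denom_ne_zero' γ)

lemma continuous_rscale (a : ℝ) (ha : 0 < a) : Continuous (rscale a ha) := by
  rw [UpperHalfPlane.isOpenEmbedding_coe.isInducing.continuous_iff]
  exact continuous_const.mul UpperHalfPlane.continuous_coe

lemma discriminant_eq_eulerProd (τ : ℍ) :
    ModularForm.discriminant τ = qexp τ * eulerProd (qexp τ) ^ 24 := by
  have h : Function.Periodic.qParam 1 τ = qexp τ := by simp [Function.Periodic.qParam, qexp]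
  rw [ModularForm.discriminant_eq_q_prod, h, eulerProd,
    ← (ModularForm.multipliable_one_sub_pow (norm_qexp_lt_one τ)).tprod_pow]
  simp only [ModularForm.eta_q, h]

lemma smul_eq_of_slash_eq {k : ℤ} {f : ℍ → ℂ} {γ : SL(2, ℤ)} (h : f ∣[k] γ = f) (τ : ℍ) :
    f (γ • τ) = (γ 1 0 * τ + γ 1 1 : ℂ) ^ k * f τ := by
  have h := congrFun h τ
  have hd := denom_ne_zero' γ τ
  have hden : denom (Matrix.SpecialLinearGroup.toGL
      ((Matrix.SpecialLinearGroup.map (Int.castRingHom ℝ)) γ)) τ = (γ 1 0 * τ + γ 1 1 : ℂ) := by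
    simp [denom]
  rw [ModularForm.SL_slash_apply, hden] at h
  generalize (γ 1 0 * τ + γ 1 1 : ℂ) = d at h hd ⊢
  rwa [zpow_neg, mul_inv_eq_iff_eq_mul₀ (zpow_ne_zero _ hd), mul_comm] at h

lemma discriminant_smul (γ : SL(2, ℤ)) (τ : ℍ) :
    ModularForm.discriminant (γ • τ) =
      (γ 1 0 * τ + γ 1 1 : ℂ) ^ 12 * ModularForm.discriminant τ :=
  smul_eq_of_slash_eq (SlashInvariantForm.slash_action_generators_SL2Z
    ModularForm.discriminant_S_invariant ModularForm.discriminant_T_invariant γ) τ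

/-- A continuous function on `ℍ` with a constant power is constant. -/
lemma eq_of_pow_eq_const {h : ℍ → ℂ} (hc : Continuous h) {n : ℕ} (hn : n ≠ 0) {c : ℂ}
    (hpow : ∀ τ, h τ ^ n = c) (τ σ : ℍ) : h τ = h σ := by
  have hfin : {z : ℂ | z ^ n = c}.Finite := by
    refine (Polynomial.nthRoots n c).toFinset.finite_toSet.subset fun z hz => ?_
    simpa [Polynomial.mem_nthRoots (Nat.pos_of_ne_zero hn)] using hz
  exact isPreconnected_univ.constant_of_mapsTo hfin.isDiscrete hc.continuousOn
    (fun x _ => hpow x) (Set.mem_univ τ) (Set.mem_univ σ)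

/-- The subgroup of the modular group fixing a function on `ℍ`. -/
def invariance (f : ℍ → ℂ) : Subgroup SL(2, ℤ) where
  carrier := {γ | ∀ τ, f (γ • τ) = f τ}
  mul_mem' {a b} ha hb τ := by rw [mul_smul, ha, hb]
  one_mem' τ := by rw [one_smul]
  inv_mem' {a} ha τ := by rw [← ha (a⁻¹ • τ), smul_inv_smul]

lemma mem_invariance {f : ℍ → ℂ} {γ : SL(2, ℤ)} : γ ∈ invariance f ↔ ∀ τ, f (γ • τ) = f τ :=
  Iff.rfl

/-- The quotient `(∏ (1 - z^{pn}) / ∏ (1 - zⁿ))^{24/(p-1)}`. -/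
def etaQuot (p : ℕ) (z : ℂ) : ℂ := (eulerProd (z ^ p) / eulerProd z) ^ (24 / (p - 1))

/-- The function `Φ_p(τ) = (η(pτ)/η(τ))^{24/(p-1)}`. -/
def hauptmodul (p : ℕ) (τ : ℍ) : ℂ := qexp τ * etaQuot p (qexp τ)

lemma differentiableOn_eulerProd_pow {d : ℕ} (hd : d ≠ 0) :
    DifferentiableOn ℂ (fun z => eulerProd (z ^ d)) (Metric.ball 0 1) := by
  obtain ⟨B, -, hB⟩ := exists_hasDiscSeries_eulerProd hd
  exact hB.differentiableOn

lemma differentiableOn_etaQuot {p : ℕ} (hp : p ≠ 0) :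
    DifferentiableOn ℂ (etaQuot p) (Metric.ball 0 1) := by
  have h1 := differentiableOn_eulerProd_pow one_ne_zero
  simp only [pow_one] at h1
  exact ((differentiableOn_eulerProd_pow hp).fun_div h1
    fun z hz => eulerProd_ne_zero (by simpa using hz)).fun_pow _

lemma continuous_hauptmodul {p : ℕ} (hp : p ≠ 0) : Continuous (hauptmodul p) :=
  continuous_comp_qexp (g := fun z => z * etaQuot p z)
    (differentiableOn_id.fun_mul (differentiableOn_etaQuot hp))

lemma etaQuot_ne_zero {p : ℕ} (hp : p ≠ 0) {z : ℂ} (hz : ‖z‖ < 1) : etaQuot p z ≠ 0 :=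
  pow_ne_zero _ (div_ne_zero (eulerProd_ne_zero (norm_pow_lt_one hz hp)) (eulerProd_ne_zero hz))

lemma hauptmodul_ne_zero {p : ℕ} (hp : p ≠ 0) (τ : ℍ) : hauptmodul p τ ≠ 0 :=
  mul_ne_zero (qexp_ne_zero τ) (etaQuot_ne_zero hp (norm_qexp_lt_one τ))

lemma hauptmodul_pow_mul_discriminant {p : ℕ} (hp : (0 : ℝ) < p) (hp' : p - 1 ∣ 24) (τ : ℍ) :
    hauptmodul p τ ^ (p - 1) * ModularForm.discriminant τ =
      ModularForm.discriminant (rscale p hp τ) := by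
  have hp0 : p ≠ 0 := by rintro rfl; simp at hp
  have h1 := eulerProd_ne_zero (norm_qexp_lt_one τ)
  rw [discriminant_eq_eulerProd, discriminant_eq_eulerProd, qexp_rscale, hauptmodul, etaQuot,
    mul_pow, ← pow_mul, Nat.div_mul_cancel hp', div_pow]
  obtain ⟨n, rfl⟩ := Nat.exists_eq_succ_of_ne_zero hp0
  simp only [Nat.succ_eq_add_one, Nat.add_sub_cancel]
  field_simp
  ring

variable {p : ℕ}

lemma hauptmodul_smul_pow (hp : (0 : ℝ) < p) (hp' : p - 1 ∣ 24) {γ : SL(2, ℤ)}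
    (hγ : γ ∈ Gamma0 p) (τ : ℍ) :
    hauptmodul p (γ • τ) ^ (p - 1) = hauptmodul p τ ^ (p - 1) := by
  obtain ⟨c, hc⟩ := Gamma0_mem_iff_dvd.mp hγ
  let γ' : SL(2, ℤ) := ⟨!![γ 0 0, p * γ 0 1; c, γ 1 1], by
    
    have := det_eq γ
    rw [hc] at this
    rw [Matrix.det_fin_two_of]
    linear_combination this⟩
  have hp0 : (p : ℂ) ≠ 0 := by exact_mod_cast hp.ne'
  have key : rscale p hp (γ • τ) = γ' • rscale p hp τ := by
    ext1
    rw [coe_smul_eq]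
    simp only [rscale, coe_smul_eq, hc, γ']
    simp
    ring
  have h1 := hauptmodul_pow_mul_discriminant hp hp' (γ • τ)
  rw [key, discriminant_smul, discriminant_smul, ← hauptmodul_pow_mul_discriminant hp hp'] at h1
  have h2 : (γ' 1 0 * rscale p hp τ + γ' 1 1 : ℂ) = γ 1 0 * τ + γ 1 1 := by
    simp [γ', rscale, hc]; ring
  rw [h2, mul_left_comm] at h1
  exact mul_right_cancel₀ (ModularForm.discriminant_ne_zero τ)
    (mul_left_cancel₀ (pow_ne_zero 12 (denom_ne_zero' γ τ)) h1)

lemma mem_invariance_hauptmodul_of_fixed (hp : (0 : ℝ) < p) (hp1 : p - 1 ≠ 0)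
    (hp' : p - 1 ∣ 24) {γ : SL(2, ℤ)} (hγ : γ ∈ Gamma0 p) {τ₀ : ℍ} (hfix : γ • τ₀ = τ₀) :
    γ ∈ invariance (hauptmodul p) := fun τ => by
  have hp0 : p ≠ 0 := by rintro rfl; simp at hp
  have h0 := hauptmodul_ne_zero hp0
  have hcont : Continuous fun τ => hauptmodul p (γ • τ) / hauptmodul p τ :=
    ((continuous_hauptmodul hp0).comp (continuous_SL2Z_smul γ)).div (continuous_hauptmodul hp0) h0
  have := eq_of_pow_eq_const hcont hp1 (c := 1) (fun σ => by
    rw [div_pow, hauptmodul_smul_pow hp hp' hγ, div_self (pow_ne_zero _ (h0 σ))]) τ τ₀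
  rw [hfix, div_self (h0 τ₀)] at this
  exact (div_eq_one_iff_eq (h0 τ)).mp this

/-- The Fricke involution inverts `Φ_p` up to a constant. -/
lemma exists_hauptmodul_S_smul_mul (hp : (0 : ℝ) < p) (hp1 : p - 1 ≠ 0) (hp' : p - 1 ∣ 24) :
    ∃ C : ℂ, ∀ τ : ℍ,
      hauptmodul p (ModularGroup.S • τ) * hauptmodul p (rscale (p : ℝ)⁻¹ (inv_pos.mpr hp) τ) = C := by
  have hp0 : p ≠ 0 := by rintro rfl; simp at hp
  have hpC : (p : ℂ) ≠ 0 := by exact_mod_cast hp0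
  have hcont : Continuous fun τ => hauptmodul p (ModularGroup.S • τ) *
      hauptmodul p (rscale (p : ℝ)⁻¹ (inv_pos.mpr hp) τ) :=
    ((continuous_hauptmodul hp0).comp (continuous_SL2Z_smul _)).mul
      ((continuous_hauptmodul hp0).comp (continuous_rscale _ _))
  refine ⟨_, fun τ => eq_of_pow_eq_const hcont hp1
    (c := ((p : ℂ) ^ 12)⁻¹) (fun σ => ?_) τ UpperHalfPlane.I⟩
  have h1 := hauptmodul_pow_mul_discriminant hp hp' (ModularGroup.S • σ)
  have h2 := hauptmodul_pow_mul_discriminant hp hp' (rscale (p : ℝ)⁻¹ (inv_pos.mpr hp) σ)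
  have e1 : rscale p hp (ModularGroup.S • σ) =
      ModularGroup.S • rscale (p : ℝ)⁻¹ (inv_pos.mpr hp) σ := by
    ext1
    rw [modular_S_smul, modular_S_smul]
    simp [rscale, mul_comm]
  have e2 : rscale p hp (rscale (p : ℝ)⁻¹ (inv_pos.mpr hp) σ) = σ := by
    ext1
    simp [rscale, hpC]
  rw [e1, discriminant_smul, discriminant_smul] at h1
  rw [e2] at h2
  rw [← h2] at h1
  have hσ := σ.ne_zero
  have hΔ := ModularForm.discriminant_ne_zero (rscale (p : ℝ)⁻¹ (inv_pos.mpr hp) σ)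
  set D := ModularForm.discriminant (rscale (p : ℝ)⁻¹ (inv_pos.mpr hp) σ)
  have e3 : (ModularGroup.S 1 0 * (rscale (p : ℝ)⁻¹ (inv_pos.mpr hp) σ : ℂ) +
      ModularGroup.S 1 1 : ℂ) = σ / p := by
    simp [ModularGroup.S, rscale, div_eq_inv_mul]
  have e4 : (ModularGroup.S 1 0 * (σ : ℂ) + ModularGroup.S 1 1 : ℂ) = σ := by
    simp [ModularGroup.S]
  rw [e3, e4] at h1
  rw [mul_pow, ← mul_left_inj' (mul_ne_zero (pow_ne_zero 12 hσ) hΔ)]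
  refine Eq.trans (by ring) (h1.trans ?_)
  rw [div_pow]
  ring

lemma lowerUnipotent_mul_S (n : ℤ) :
    lowerUnipotent n * ModularGroup.S = ModularGroup.S * ModularGroup.T ^ (-n) := by
  ext i j
  rw [Matrix.SpecialLinearGroup.coe_mul, Matrix.SpecialLinearGroup.coe_mul,
    ModularGroup.coe_T_zpow]
  fin_cases i <;> fin_cases j <;> simp [lowerUnipotent, ModularGroup.S, Matrix.mul_apply]

/-- `Φ_p` is invariant under `Γ₀(p)`. -/
lemma Gamma0_le_invariance_hauptmodul (hp : p ∈ ({2, 3, 5} : Set ℕ)) :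
    Gamma0 p ≤ invariance (hauptmodul p) := by
  have hpos : (0 : ℝ) < p := by rcases hp with rfl | rfl | rfl <;> norm_num
  have hp1 : p - 1 ≠ 0 := by rcases hp with rfl | rfl | rfl <;> norm_num
  have hp' : p - 1 ∣ 24 := by rcases hp with rfl | rfl | rfl <;> norm_num
  have hp0 : p ≠ 0 := by rintro rfl; simp at hpos
  refine Gamma0_le_of_generators hp (fun τ => ?_) (fun j τ => ?_) (fun n τ => ?_) ?_
  · rw [ModularGroup.SL_neg_smul, one_smul]
  · rw [hauptmodul, qexp_T_zpow_smul, hauptmodul]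
  · obtain ⟨C, hC⟩ := exists_hauptmodul_S_smul_mul hpos hp1 hp'
    obtain ⟨σ, rfl⟩ : ∃ σ : ℍ, τ = ModularGroup.S • σ := ⟨_, (smul_inv_smul _ _).symm⟩
    rw [← mul_smul, lowerUnipotent_mul_S, mul_smul]
    refine mul_right_cancel₀ (hauptmodul_ne_zero hp0 (rscale _ (inv_pos.mpr hpos) σ)) ?_
    rw [hC, ← hC (ModularGroup.T ^ (-(p * n : ℤ)) • σ)]
    congr 1
    have : rscale (p : ℝ)⁻¹ (inv_pos.mpr hpos) (ModularGroup.T ^ (-(p * n : ℤ)) • σ) =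
        ModularGroup.T ^ (-n) • rscale (p : ℝ)⁻¹ (inv_pos.mpr hpos) σ := by
      ext1
      rw [modular_T_zpow_smul, modular_T_zpow_smul]
      have hpC : (p : ℂ) ≠ 0 := by exact_mod_cast hp0
      simp [rscale]
      field_simp
    rw [this, hauptmodul, hauptmodul, qexp_T_zpow_smul]
  · rintro rfl
    constructor
    · refine mem_invariance_hauptmodul_of_fixed hpos hp1 hp'
        (Gamma0_mem_iff_dvd.mpr (by simp [elliptic])) (τ₀ := ⟨(2 + Complex.I) / 5, by simp⟩) ?_
      ext1
      rw [coe_smul_eq]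
      simp [elliptic]
      rw [div_eq_iff (by ring_nf; simp)]
      ring_nf
      simp
      ring
    · refine mem_invariance_hauptmodul_of_fixed hpos hp1 hp'
        (Gamma0_mem_iff_dvd.mpr (by simp [elliptic'])) (τ₀ := ⟨(-2 + Complex.I) / 5, by simp⟩) ?_
      ext1
      rw [coe_smul_eq]
      simp [elliptic']
      rw [div_eq_iff (by ring_nf; simp)]
      ring_nf
      simp
      ring

end Hauptmodul

section BoundedForms

lemma isBoundedAtImInfty_smul_T_zpow {f : ℍ → ℂ} (hf : IsBoundedAtImInfty f) (j : ℤ) :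
    IsBoundedAtImInfty fun τ => f (ModularGroup.T ^ j • τ) := by
  rw [isBoundedAtImInfty_iff] at hf ⊢
  obtain ⟨M, A, h⟩ := hf
  refine ⟨M, A, fun z hz => h _ ?_⟩
  rwa [modular_T_zpow_smul, vadd_im]

lemma isBoundedAtImInfty_rscale {f : ℍ → ℂ} (hf : IsBoundedAtImInfty f) {a : ℝ} (ha : 0 < a) :
    IsBoundedAtImInfty fun τ => f (rscale a ha τ) := by
  rw [isBoundedAtImInfty_iff] at hf ⊢
  obtain ⟨M, A, h⟩ := hf
  refine ⟨M, A / a, fun z hz => h _ ?_⟩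
  have : (rscale a ha z).im = a * z.im := by
    rw [← coe_im, ← coe_im, rscale, Complex.im_ofReal_mul]
  rwa [this, ← div_le_iff₀' ha]

lemma isBoundedAtImInfty_of_hasSum_qexp {f : ℍ → ℂ} {c : ℕ → ℂ} (h : HasHoloExpansion f c) :
    IsBoundedAtImInfty f := by
  refine isBoundedAtImInfty_of_hasSum_qExpansion (c := c) one_pos fun τ => ?_
  simpa [Function.Periodic.qParam, qexp] using h τ

lemma HasDiscSeries.isBoundedAtImInfty {g : ℂ → ℂ} {A : PowerSeries ℂ} (hg : HasDiscSeries g A) :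
    IsBoundedAtImInfty fun τ => g (qexp τ) :=
  isBoundedAtImInfty_of_hasSum_qexp fun τ => hg _ (norm_qexp_lt_one τ)

/-- Every cusp of `Γ₀(p)` is equivalent to `∞` or to `0`. -/
lemma mem_Gamma0_or_exists_eq_mul_S {p : ℕ} (hp : p.Prime) (γ : SL(2, ℤ)) :
    γ ∈ Gamma0 p ∨ ∃ δ ∈ Gamma0 p, ∃ j : ℤ, γ = δ * (ModularGroup.S * ModularGroup.T ^ j) := by
  refine or_iff_not_imp_left.mpr fun hγ => ?_
  rw [Gamma0_mem_iff_dvd] at hγ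
  obtain ⟨u, v, huv⟩ := (Nat.prime_iff_prime_int.mp hp).coprime_iff_not_dvd.mpr hγ
  refine ⟨γ * (ModularGroup.S * ModularGroup.T ^ (v * γ 1 1))⁻¹, ?_, v * γ 1 1, (inv_mul_cancel_right _ _).symm⟩
  rw [Gamma0_mem_iff_dvd, mul_inv_rev, ← zpow_neg, ← mul_assoc]
  refine ⟨-(γ 1 1 * u), ?_⟩
  have h1 : ∀ M : SL(2, ℤ), (M * ModularGroup.S⁻¹) 1 0 = -M 1 1 := fun M => by
    rw [ModularGroup.S_inv, Matrix.SpecialLinearGroup.coe_mul, Matrix.mul_apply, Fin.sum_univ_two]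
    simp [ModularGroup.coe_S, Matrix.SpecialLinearGroup.coe_neg]
  rw [h1, mul_T_zpow_apply_one_one]
  linear_combination γ 1 1 * huv

lemma exists_eq_const_of_invariant {p : ℕ} (hp : p.Prime) {f : ℍ → ℂ}
    (hf : MDifferentiable 𝓘(ℂ) 𝓘(ℂ) f) (hinv : Gamma0 p ≤ invariance f)
    (hbdd : IsBoundedAtImInfty f)
    (hbdd0 : IsBoundedAtImInfty fun τ => f (ModularGroup.S • τ)) : ∃ c, ∀ τ, f τ = c := by
  have : NeZero p := ⟨hp.ne_zero⟩
  have hslash : ∀ γ : SL(2, ℤ), f ∣[(0 : ℤ)] γ = fun τ => f (γ • τ) := fun γ => by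
    ext τ
    rw [ModularForm.SL_slash_apply]
    simp
  let F : ModularForm (Gamma0 p) 0 :=
    { toFun := f
      slash_action_eq' := by
        rintro _ ⟨γ, hγ, rfl⟩
        exact (hslash γ).trans (funext (hinv hγ))
      holo' := hf
      bdd_at_cusps' := fun {c} hc => by
        rw [Subgroup.IsArithmetic.isCusp_iff_isCusp_SL2Z] at hc
        rw [OnePoint.isBoundedAt_iff_forall_SL2Z hc]
        intro γ _
        rw [hslash]
        rcases mem_Gamma0_or_exists_eq_mul_S hp γ with hγ | ⟨δ, hδ, j, rfl⟩
        · exact (funext (hinv hγ)).symm ▸ hbdd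
        · simp only [mul_smul, mem_invariance.mp (hinv hδ)]
          exact isBoundedAtImInfty_smul_T_zpow hbdd0 j }
  obtain ⟨c, hc⟩ := ModularForm.eq_const_of_weight_zero F
  exact ⟨c, congrFun hc⟩

end BoundedForms

lemma exists_qexp_eq {z : ℂ} (hz0 : z ≠ 0) (hz : ‖z‖ < 1) : ∃ τ : ℍ, qexp τ = z := by
  have h : (Complex.log z / (2 * π * Complex.I)).im = -Real.log ‖z‖ / (2 * π) := by
    rw [show Complex.log z / (2 * π * Complex.I) =
        -(Complex.log z * Complex.I) / ((2 * π : ℝ) : ℂ) by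
      have := Real.pi_ne_zero
      push_cast
      field_simp
      simp, Complex.div_ofReal_im]
    simp [Complex.log_re]
  refine ⟨⟨Complex.log z / (2 * π * Complex.I), ?_⟩, ?_⟩
  · rw [h]
    exact div_pos (neg_pos.mpr (Real.log_neg (norm_pos_iff.mpr hz0) hz)) Real.two_pi_pos
  · rw [qexp, mul_div_cancel₀ _ Complex.two_pi_I_ne_zero, Complex.exp_log hz0]

lemma exists_etaQuot_series {p : ℕ} (hp : p ≠ 0) :
    ∃ N N' : PowerSeries ℤ, N * N' = 1 ∧
      HasDiscSeries (etaQuot p) (N.map (Int.castRingHom ℂ)) ∧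
      HasDiscSeries (fun z => (etaQuot p z)⁻¹) (N'.map (Int.castRingHom ℂ)) := by
  have key : ∀ {d : ℕ}, d ≠ 0 → ∃ B B' : PowerSeries ℤ, B * B' = 1 ∧
      HasDiscSeries (fun z => eulerProd (z ^ d)) (B.map (Int.castRingHom ℂ)) ∧
      HasDiscSeries (fun z => (eulerProd (z ^ d))⁻¹) (B'.map (Int.castRingHom ℂ)) := by
    intro d hd
    obtain ⟨B, hB1, hB⟩ := exists_hasDiscSeries_eulerProd hd
    obtain ⟨B', hB'⟩ := (PowerSeries.isUnit_iff_constantCoeff.mpr (hB1 ▸ isUnit_one)).exists_right_inv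
    exact ⟨B, B', hB', hB, hB.inv (fun z hz => eulerProd_ne_zero (norm_pow_lt_one hz hd))
      (by rw [← map_mul, hB', map_one])⟩
  obtain ⟨B, B', hBB', hB, hB'⟩ := key hp
  obtain ⟨D, D', hDD', hD, hD'⟩ := key one_ne_zero
  simp only [pow_one] at hD hD'
  refine ⟨(B * D') ^ (24 / (p - 1)), (B' * D) ^ (24 / (p - 1)), ?_, ?_, ?_⟩
  · rw [← mul_pow, show B * D' * (B' * D) = (B * B') * (D * D') by ring, hBB', hDD', one_mul,
      one_pow]
  · rw [map_pow, map_mul]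
    exact ((hB.mul hD').pow _).congr fun z _ => by rw [etaQuot, div_eq_mul_inv]
  · rw [map_pow, map_mul]
    exact ((hB'.mul hD).pow _).congr fun z _ => by
      rw [etaQuot, ← inv_pow, inv_div, div_eq_mul_inv, mul_comm]

/-- A `Γ₀(p)`-invariant function with integral expansion at `∞` and a pole of order at most `m`
at `0` reduces to zero as soon as its first coefficients do. -/
lemma map_eq_zero_of_X_pow_dvd {p : ℕ} (hp : p ∈ ({2, 3, 5} : Set ℕ)) (hpos : (0 : ℝ) < p)
    {R : Type*} [CommRing R] (φ : ℤ →+* R) (m : ℕ) {g : ℂ → ℂ} {A : PowerSeries ℤ}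
    (hg : HasDiscSeries g (A.map (Int.castRingHom ℂ)))
    (hinv : Gamma0 p ≤ invariance fun τ => g (qexp τ)) (hA0 : A.constantCoeff = 0)
    (hA : PowerSeries.X ^ (m + 1) ∣ A.map φ)
    (hbdd : IsBoundedAtImInfty fun τ =>
      qexp (rscale (p : ℝ)⁻¹ (inv_pos.mpr hpos) τ) ^ m * g (qexp (ModularGroup.S • τ))) :
    A.map φ = 0 := by
  have hprime : p.Prime := by rcases hp with rfl | rfl | rfl <;> norm_num
  have hp1 : p - 1 ≠ 0 := by rcases hp with rfl | rfl | rfl <;> norm_num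
  have hp' : p - 1 ∣ 24 := by rcases hp with rfl | rfl | rfl <;> norm_num
  induction m generalizing g A with
  | zero =>
    obtain ⟨c, hc⟩ := exists_eq_const_of_invariant hprime (mdifferentiable_comp_qexp
      hg.differentiableOn) hinv hg.isBoundedAtImInfty (by simpa using hbdd)
    have h1 : HasDiscSeries (fun _ => 0)
        (PowerSeries.X * (A.map (Int.castRingHom ℂ) - PowerSeries.C c)) :=
      (HasDiscSeries.id.mul (hg.sub (.const c))).congr fun z hz => by
        rcases eq_or_ne z 0 with rfl | hz0
        · simp
        · obtain ⟨τ, rfl⟩ := exists_qexp_eq hz0 hz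
          rw [hc, sub_self, mul_zero]
    have h2 := h1.unique (.const 0)
    rw [map_zero, mul_eq_zero, or_iff_right PowerSeries.X_ne_zero, sub_eq_zero] at h2
    have h3 : c = 0 := by
      have := congrArg (PowerSeries.coeff 0) h2
      rw [PowerSeries.coeff_map, PowerSeries.coeff_zero_eq_constantCoeff_apply, hA0] at this
      simpa using this.symm
    have h4 : A = 0 := PowerSeries.map_injective _ (RingHom.injective_int (Int.castRingHom ℂ))
      (by rw [h2, h3, map_zero, map_zero])
    rw [h4, map_zero]
  | succ m ih =>
    obtain ⟨N, N', hNN', hN, hN'⟩ := exists_etaQuot_series hprime.ne_zero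
    obtain ⟨C, hC⟩ := exists_hauptmodul_S_smul_mul hpos hp1 hp'
    obtain ⟨A₁, rfl⟩ := PowerSeries.X_dvd_iff.mpr hA0
    rw [map_mul, PowerSeries.map_X] at hg hA ⊢
    obtain ⟨g₁, hg₁, hgg₁⟩ := hg.exists_of_X_mul
    have hquot : ∀ τ : ℍ,
        g₁ (qexp τ) * (etaQuot p (qexp τ))⁻¹ = g (qexp τ) / hauptmodul p τ := fun τ => by
      rw [hgg₁ _ (norm_qexp_lt_one τ), hauptmodul, mul_div_mul_left _ _ (qexp_ne_zero τ),
        div_eq_mul_inv]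
    set b := (A₁ * N').constantCoeff
    have hdvd : PowerSeries.X ^ (m + 1) ∣ (A₁ * N').map φ := by
      rw [map_mul]
      obtain ⟨D, hD⟩ := hA
      rw [pow_succ', mul_assoc] at hD
      exact Dvd.dvd.mul_right ⟨D, PowerSeries.X_mul_cancel hD⟩ _
    have hb : φ b = 0 := by
      have := PowerSeries.X_dvd_iff.mp ((dvd_pow_self _ m.succ_ne_zero).trans hdvd)
      rwa [← PowerSeries.coeff_zero_eq_constantCoeff_apply, PowerSeries.coeff_map,
        PowerSeries.coeff_zero_eq_constantCoeff_apply] at this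
    have hmap : (A₁ * N' - PowerSeries.C b).map φ = (A₁ * N').map φ := by
      rw [map_sub, PowerSeries.map_C, hb, map_zero, sub_zero]
    have key : (A₁ * N' - PowerSeries.C b).map φ = 0 := by
      refine ih (g := fun z => g₁ z * (etaQuot p z)⁻¹ - b) ?_ (fun γ hγ τ => ?_) ?_
        (hmap ▸ hdvd) ?_
      · simpa using (hg₁.mul hN').sub (.const (b : ℂ))
      · have h1 := mem_invariance.mp (hinv hγ) τ
        have h2 := mem_invariance.mp (Gamma0_le_invariance_hauptmodul hp hγ) τ
        simp only [hquot]
        rw [h1, h2]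
      · simp [b]
      · have hw : IsBoundedAtImInfty fun τ =>
            qexp (rscale (p : ℝ)⁻¹ (inv_pos.mpr hpos) τ) ^ m * (b : ℂ) :=
          isBoundedAtImInfty_rscale
            ((HasDiscSeries.id.pow m).mul (.const (b : ℂ))).isBoundedAtImInfty _
        have hη : IsBoundedAtImInfty fun τ =>
            etaQuot p (qexp (rscale (p : ℝ)⁻¹ (inv_pos.mpr hpos) τ)) * C⁻¹ :=
          isBoundedAtImInfty_rscale (hN.mul (.const C⁻¹)).isBoundedAtImInfty _
        refine ((hbdd.mul hη).sub hw).congr_left fun τ => ?_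
        simp only [hquot, Pi.mul_apply]
        rw [← hC τ, hauptmodul, hauptmodul]
        have h1 := qexp_ne_zero (rscale (p : ℝ)⁻¹ (inv_pos.mpr hpos) τ)
        have h2 := etaQuot_ne_zero hprime.ne_zero
          (norm_qexp_lt_one (rscale (p : ℝ)⁻¹ (inv_pos.mpr hpos) τ))
        have h3 := qexp_ne_zero (ModularGroup.S • τ)
        have h4 := etaQuot_ne_zero hprime.ne_zero (norm_qexp_lt_one (ModularGroup.S • τ))
        generalize qexp (rscale (p : ℝ)⁻¹ (inv_pos.mpr hpos) τ) = w at *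
        generalize qexp (ModularGroup.S • τ) = u at *
        field_simp
        ring
    rw [hmap, map_mul] at key
    have : A₁.map φ = A₁.map φ * N'.map φ * N.map φ := by
      rw [mul_assoc, ← map_mul, mul_comm N', hNN', map_one, mul_one]
    rw [this, key, zero_mul, mul_zero]

lemma exists_hasDiscSeries_of_qexp {f : ℍ → ℂ} {A : PowerSeries ℂ}
    (h : HasHoloExpansion f fun n => A.coeff n) :
    ∃ g, HasDiscSeries g A ∧ ∀ τ, f τ = g (qexp τ) := by
  have hs : ∀ z : ℂ, ‖z‖ < 1 → Summable fun n : ℕ => A.coeff n * z ^ n := fun z hz => by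
    rcases eq_or_ne z 0 with rfl | hz0
    · exact summable_of_ne_finset_zero (s := {0}) fun n hn => by simp_all
    · obtain ⟨τ, rfl⟩ := exists_qexp_eq hz0 hz
      exact (h τ).summable
  exact ⟨fun z => ∑' n : ℕ, A.coeff n * z ^ n, fun z hz => (hs z hz).hasSum,
    fun τ => (h τ).tsum_eq.symm⟩

lemma HasExpansion.hasHoloExpansion {f : ℍ → ℂ} {c : ℤ → ℂ} (h : HasExpansion f c)
    (hc : ∀ n < 0, c n = 0) : HasHoloExpansion f fun n => c n := fun τ => by
  refine ((Nat.cast_injective (R := ℤ)).hasSum_iff (f := fun n : ℤ => c n * qexp τ ^ n)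
    fun n hn => ?_).mpr (h.2 τ) |>.congr_fun fun n => by simp
  rw [hc n (lt_of_not_ge fun h0 => hn ⟨n.toNat, Int.toNat_of_nonneg h0⟩), zero_mul]

/-- The pole order at `0` read off from the expansion there. -/
lemma HasExpansionAtZero.isBoundedAtImInfty {p : ℕ} (hpos : (0 : ℝ) < p) {k : ℤ} {f : ℍ → ℂ}
    {c : ℤ → ℂ} (h : HasExpansionAtZero p k f c) {m : ℕ} (hc : ∀ n : ℤ, n < -(m : ℤ) → c n = 0) :
    IsBoundedAtImInfty fun τ => qexp (rscale (p : ℝ)⁻¹ (inv_pos.mpr hpos) τ) ^ m *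
      ((τ : ℂ) ^ (-k) * f (neginv τ)) := by
  refine isBoundedAtImInfty_rscale (f := fun τ => qexp τ ^ m *
    ((rscale p hpos τ : ℂ) ^ (-k) * f (neginv (rscale p hpos τ))))
    (isBoundedAtImInfty_of_hasSum_qexp (c := fun n : ℕ => c (n - m)) fun τ => ?_)
    (inv_pos.mpr hpos) |>.congr_left fun τ => ?_
  · have h1 := (h.2 (rscale p hpos τ)).mul_left (qexp τ ^ m)
    have hpC : (p : ℂ) ≠ 0 := by exact_mod_cast hpos.ne'
    have h2 : ∀ n : ℤ, Complex.exp (2 * π * Complex.I * n * (rscale p hpos τ) / p) =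
        qexp τ ^ n := fun n => by
      rw [qexp, ← Complex.exp_int_mul]
      congr 1
      simp only [rscale, ofReal_natCast]
      field_simp
    rw [← (Equiv.subRight (m : ℤ)).hasSum_iff] at h1
    refine (((Nat.cast_injective (R := ℤ)).hasSum_iff fun n hn => ?_).mpr h1).congr_fun fun n => ?_
    · simp only [Function.comp, Equiv.subRight_apply]
      rw [hc (n - m), zero_mul, mul_zero]
      have : n < 0 := lt_of_not_ge fun h0 => hn ⟨n.toNat, Int.toNat_of_nonneg h0⟩
      linarith
    · simp only [Function.comp, Equiv.subRight_apply, h2]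
      rw [zpow_sub₀ (qexp_ne_zero τ), zpow_natCast, zpow_natCast]
      field_simp [qexp_ne_zero τ]
  · have : rscale p hpos (rscale (p : ℝ)⁻¹ (inv_pos.mpr hpos) τ) = τ := by
      have hpC : (p : ℂ) ≠ 0 := by exact_mod_cast hpos.ne'
      ext1
      simp [rscale, hpC]
    rw [this]

lemma isBoundedAtImInfty_S_smul {p : ℕ} [NeZero p] {k : ℤ} (F : ModularForm (Gamma0 p) k) :
    IsBoundedAtImInfty fun τ => (τ : ℂ) ^ (-k) * F (ModularGroup.S • τ) := by
  have hc := isCusp_SL2Z_iff'.mpr ⟨ModularGroup.S, rfl⟩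
  have h := F.bdd_at_cusps' ((Subgroup.IsArithmetic.isCusp_iff_isCusp_SL2Z _).mpr hc)
  refine ((OnePoint.isBoundedAt_iff_forall_SL2Z hc).mp h _ rfl).congr_left fun τ => ?_
  rw [ModularForm.SL_slash_apply, mul_comm]
  exact congrArg (fun d => d ^ (-k) * _) (ModularGroup.denom_S τ)

/-- If `α = 1 + ∑_{n≥1} aₙ qⁿ` of negative even weight on `Γ₀(p)` has integer
coefficients, a pole of order `m` at `0`, `pʳ ∣ aᵢ` for `1 ≤ i ≤ m`, and some
`F ∈ M_{-k}(Γ₀(p))` with integer coefficients has `F ≡ 1 (mod pʳ)`, then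
`α ≡ 1 (mod pʳ)`. -/
theorem stmt_15 (p : ℕ) (hp : p ∈ ({2, 3, 5} : Set ℕ)) (k : ℤ) (hk : Even k)
    (hkneg : k < 0) (α : WhmForm (Gamma0 p) k) (a : ℤ → ℤ)
    (hint : ∀ n : ℤ, α.coeff n = (a n : ℂ))
    (hhol : ∀ n : ℤ, n < 0 → α.coeff n = 0) (ha0 : a 0 = 1)
    (c0 : ℤ → ℂ) (h0 : HasExpansionAtZero p k α.toFun c0)
    (m : ℕ) (hpole : c0 (-(m : ℤ)) ≠ 0 ∧ ∀ n : ℤ, n < -(m : ℤ) → c0 n = 0)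
    (r : ℕ) (hdiv : ∀ i : ℕ, 1 ≤ i → i ≤ m → (p : ℤ) ^ r ∣ a i)
    (F : ModularForm (Gamma0 p) (-k)) (cF : ℕ → ℤ)
    (hF : HasHoloExpansion (⇑F) (fun n => (cF n : ℂ)))
    (hF0 : cF 0 = 1) (hFcong : ∀ n : ℕ, 1 ≤ n → (p : ℤ) ^ r ∣ cF n) :
    ∀ n : ℤ, 1 ≤ n → (p : ℤ) ^ r ∣ a n := by
  have hpos : (0 : ℝ) < p := by rcases hp with rfl | rfl | rfl <;> norm_num
  have : NeZero p := ⟨by rintro rfl; simp at hpos⟩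
  let φ := Int.castRingHom (ZMod (p ^ r))
  have hφ : ∀ x : ℤ, φ x = 0 ↔ (p : ℤ) ^ r ∣ x := fun x => by
    simpa using ZMod.intCast_zmod_eq_zero_iff_dvd x (p ^ r)
  let A : PowerSeries ℤ := .mk fun n => a n
  let B : PowerSeries ℤ := .mk cF
  have hB : B.map φ = 1 := by
    ext n
    rcases n with _ | n
    · simp [B, hF0]
    · simp [B, PowerSeries.coeff_one, ← hφ] at hFcong ⊢
      exact hFcong _ (by lia)
  obtain ⟨gα, hgα, hα⟩ := exists_hasDiscSeries_of_qexp (f := α.toFun)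
    (A := A.map (Int.castRingHom ℂ)) (by
      simpa [A, ← hint] using α.expansion.hasHoloExpansion hhol)
  obtain ⟨gF, hgF, hF'⟩ := exists_hasDiscSeries_of_qexp (f := F)
    (A := B.map (Int.castRingHom ℂ)) (by simpa [B] using hF)
  have key : (A * B - 1).map φ = 0 := by
    refine map_eq_zero_of_X_pow_dvd hp hpos φ m (g := fun z => gα z * gF z - 1) ?_
      (fun γ hγ τ => ?_) ?_ ?_ ?_
    · simpa using (hgα.mul hgF).sub .one
    · have hF_slash : ⇑F ∣[-k] γ = ⇑F := F.slash_action_eq' _ ⟨γ, hγ, rfl⟩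
      simp only [← hα, ← hF', smul_eq_of_slash_eq (α.slash_eq γ hγ), smul_eq_of_slash_eq hF_slash]
      rw [zpow_neg]
      field_simp [zpow_ne_zero k (denom_ne_zero' γ τ)]
    · simp [A, B, ha0, hF0]
    · rw [map_sub, map_mul, hB, mul_one, map_one, PowerSeries.X_pow_dvd_iff]
      intro i hi
      rcases i with _ | i
      · rw [map_sub, PowerSeries.coeff_map]
        simp [A, ha0]
      · simpa [A, PowerSeries.coeff_one, hφ] using (hφ _).mpr (hdiv (i + 1) (by lia) (by lia))
    · refine (((h0.isBoundedAtImInfty hpos hpole.2).mul (isBoundedAtImInfty_S_smul F)).sub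
        (isBoundedAtImInfty_rscale (HasDiscSeries.id.pow m).isBoundedAtImInfty
          (inv_pos.mpr hpos))).congr_left fun τ => ?_
      simp only [Pi.mul_apply, ← hα, ← hF', modular_S_smul, neginv, neg_neg]
      have := τ.ne_zero
      rw [zpow_neg]
      field_simp
  rw [map_sub, map_mul, hB, mul_one, map_one, sub_eq_zero] at key
  intro n hn
  lift n to ℕ using by lia
  have := congrArg (PowerSeries.coeff n) key
  rw [PowerSeries.coeff_map, PowerSeries.coeff_one, if_neg (by lia), PowerSeries.coeff_mk] at this
  exact (hφ _).mp this
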